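/- arXiv:1204.2710 — 3 statements merged into one kernel-verified Lean document; each statement's English description precedes it below -/
import Mathlib

section
/- Let C be a k-dimensional linear code over a finite field F_q with q elements, let 1 ≤ s ≤ k−1, and suppose that all s-dimensional subcodes of C have the same weight d_s. Then for every 0 ≤ t ≤ k and every t-dimensional subcode D_t of C one has (q^k − q^{k−s}) · w(D_t) = d_s · (q^k − q^{k−t}); in particular all t-dimensional subcodes of C have the same weight d_t = d_s (q^k − q^{k−t}) / (q^k − q^{k−s}). -/
/-- The support of a subcode `D` of `F_q^n`: the set of coordinates where some
codeword of `D` is nonzero. -/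
def codeSupp {F : Type*} [Field F] {n : ℕ} (D : Submodule F (Fin n → F)) : Set (Fin n) :=
  {x | ∃ d ∈ D, d x ≠ 0}

/-- The weight of a subcode: the cardinality of its support. -/
noncomputable def codeWt {F : Type*} [Field F] {n : ℕ} (D : Submodule F (Fin n → F)) : ℕ :=
  (codeSupp D).ncard

/-- Double counting: if the number of members of a family `φ` of functionals that do not vanish on
a hyperplane is independent of the hyperplane, then the number of members that do not vanish on a
subspace `D` depends only on the dimension of `D`. -/
theorem exists_forall_card_functionals_not_mem_dualAnnihilator
    {F V ι : Type*} [Field F] [Fintype F] [AddCommGroup V] [Module F V] [FiniteDimensional F V]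
    [Fintype ι] (φ : ι → Module.Dual F V) (c : ℕ)
    (h : ∀ f : Module.Dual F V, f ≠ 0 →
      {x | φ x ∉ (LinearMap.ker f).dualAnnihilator}.ncard = c) :
    ∃ a : ℕ, ∀ D : Submodule F V,
      (Fintype.card F - 1) * {x | φ x ∉ D.dualAnnihilator}.ncard =
        a * (Fintype.card F ^ Module.finrank F V -
          Fintype.card F ^ (Module.finrank F V - Module.finrank F D)) := by
  classical
  have : Finite V := Module.finite_of_finite F
  have : Finite (Module.Dual F V) := Module.finite_of_finite F
  have := Fintype.ofFinite (Module.Dual F V)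
  let r : ι → Module.Dual F V → Prop := fun x f => ∃ u : Fˣ, f = u • φ x
  refine ⟨{x | φ x ≠ 0}.ncard - c, fun D => ?_⟩
  have hcount := Finset.sum_card_bipartiteAbove_eq_sum_card_bipartiteBelow r
    (s := {x | φ x ∉ D.dualAnnihilator}) (t := {f | f ∉ D.dualAnnihilator})
  have hleft : ∀ x ∈ ({x | φ x ∉ D.dualAnnihilator} : Finset ι),
      (({f | f ∉ D.dualAnnihilator} : Finset (Module.Dual F V)).bipartiteAbove r x).card =
        Fintype.card F - 1 := by
    intro x hx
    replace hx : φ x ∉ D.dualAnnihilator := by simpa using hx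
    have hx0 : φ x ≠ 0 := fun h0 => hx (h0 ▸ zero_mem _)
    rw [← Fintype.card_units, ← Finset.card_univ,
      ← Finset.card_image_of_injective (f := fun u : Fˣ => u • φ x) Finset.univ]
    · congr 1
      ext f
      simp only [Finset.bipartiteAbove, Finset.mem_filter, Finset.mem_univ, true_and,
        Finset.mem_image, r]
      constructor
      · rintro ⟨-, u, rfl⟩
        exact ⟨u, rfl⟩
      · rintro ⟨u, rfl⟩
        refine ⟨fun hu => hx ?_, u, rfl⟩
        exact (Submodule.smul_mem_iff_of_isUnit _ u.isUnit).1 hu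
    · intro u v huv
      exact Units.ext (smul_left_injective F hx0 huv)
  have hright : ∀ f ∈ ({f | f ∉ D.dualAnnihilator} : Finset (Module.Dual F V)),
      (({x | φ x ∉ D.dualAnnihilator} : Finset ι).bipartiteBelow r f).card =
        {x | φ x ≠ 0}.ncard - c := by
    intro f hf
    replace hf : f ∉ D.dualAnnihilator := by simpa using hf
    have hf0 : f ≠ 0 := fun h0 => hf (h0 ▸ zero_mem _)
    rw [← h f hf0, ← Set.ncard_sdiff, ← Set.ncard_coe_finset]
    · congr 1
      ext x
      simp only [Finset.bipartiteBelow, Finset.coe_filter, Finset.mem_filter, Finset.mem_univ,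
        true_and, Set.mem_ofPred_eq, Set.mem_sdiff, not_not, r]
      constructor
      · rintro ⟨hx, u, rfl⟩
        refine ⟨fun h0 => hx (h0 ▸ zero_mem _), ?_⟩
        rw [Submodule.mem_dualAnnihilator]
        intro w hw
        have : (u : F) * φ x w = 0 := hw
        simpa using this
      · rintro ⟨hx, hker⟩
        rw [Submodule.mem_dualAnnihilator] at hker
        have hspan : φ x ∈ Submodule.span F (Set.range fun _ : Unit => f) :=
          mem_span_of_iInf_ker_le_ker fun w hw => hker w (by simpa using hw)
        rw [Set.range_const, Submodule.mem_span_singleton] at hspan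
        obtain ⟨b, hb⟩ := hspan
        have hb0 : b ≠ 0 := by
          rintro rfl
          exact hx (by rw [← hb, zero_smul])
        rw [← hb]
        refine ⟨fun hm => hf ((Submodule.smul_mem_iff _ hb0).1 hm), (Units.mk0 b hb0)⁻¹, ?_⟩
        rw [Units.smul_def, smul_smul]
        simp [hb0]
    · intro x hx h0
      exact hx (h0 ▸ zero_mem _)
  rw [Finset.sum_congr rfl hleft, Finset.sum_congr rfl hright, Finset.sum_const, Finset.sum_const,
    smul_eq_mul, smul_eq_mul] at hcount
  have hset : {x | φ x ∉ D.dualAnnihilator}.ncard =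
      ({x | φ x ∉ D.dualAnnihilator} : Finset ι).card := by
    rw [← Set.ncard_coe_finset]
    simp
  have hann : ({f | f ∉ D.dualAnnihilator} : Finset (Module.Dual F V)).card =
      Fintype.card F ^ Module.finrank F V -
        Fintype.card F ^ (Module.finrank F V - Module.finrank F D) := by
    have hD := Subspace.finrank_add_finrank_dualAnnihilator_eq D
    have hcard := Module.card_eq_pow_finrank (K := F) (V := D.dualAnnihilator)
    have hdual := Module.card_eq_pow_finrank (K := F) (V := Module.Dual F V)
    rw [Subspace.dual_finrank_eq] at hdual
    rw [← hdual, ← hD, Nat.add_sub_cancel_left, ← hcard, ← Fintype.card_subtype]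
    exact Fintype.card_subtype_compl _
  rw [hset, mul_comm, hcount, hann, mul_comm]

theorem exists_submodule_le_finrank_eq {F V : Type*} [Field F] [AddCommGroup V] [Module F V]
    (C : Submodule F V) {s : ℕ} (hs : s ≤ Module.finrank F C) :
    ∃ D ≤ C, Module.finrank F D = s := by
  obtain ⟨v, hv⟩ := exists_linearIndependent_of_le_finrank hs
  refine ⟨(Submodule.span F (Set.range v)).map C.subtype, Submodule.map_subtype_le _ _, ?_⟩
  rw [Submodule.finrank_map_subtype_eq, finrank_span_eq_card hv, Fintype.card_fin]

/-- If all hyperplanes of a code have the same weight, then the weight of a subcode is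
proportional to the number of functionals that do not vanish on it. -/
theorem exists_forall_codeWt_eq_of_hyperplanes
    {F : Type*} [Field F] [Fintype F] {n s : ℕ} (C : Submodule F (Fin n → F))
    (hC : Module.finrank F C = s + 1) (c : ℕ)
    (h : ∀ D ≤ C, Module.finrank F D = s → codeWt D = c) :
    ∃ a : ℕ, ∀ D ≤ C, (Fintype.card F - 1) * codeWt D =
      a * (Fintype.card F ^ (s + 1) -
        Fintype.card F ^ (s + 1 - Module.finrank F D)) := by
  let φ : Fin n → Module.Dual F C := fun x => (LinearMap.proj x).comp C.subtype
  have hwt : ∀ D : Submodule F C,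
      {x | φ x ∉ D.dualAnnihilator}.ncard = codeWt (D.map C.subtype) := by
    intro D
    unfold codeWt
    congr 1
    ext x
    simp [codeSupp, φ, Submodule.mem_dualAnnihilator]
  obtain ⟨a, ha⟩ := exists_forall_card_functionals_not_mem_dualAnnihilator φ c fun f hf => by
    rw [hwt]
    refine h _ (Submodule.map_subtype_le _ _) ?_
    have := Module.Dual.finrank_ker_add_one_of_ne_zero hf
    rw [Submodule.finrank_map_subtype_eq]
    omega
  refine ⟨a, fun D hD => ?_⟩
  have hmap : (D.comap C.subtype).map C.subtype = D := by
    rw [Submodule.map_comap_subtype, inf_eq_right.2 hD]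
  have := ha (D.comap C.subtype)
  rwa [hwt, hmap, hC, ← Submodule.finrank_map_subtype_eq, hmap] at this

/-- If all `s`-dimensional subcodes have the same weight, with `s` positive, then so do all
subcodes of dimension `s + 1`. -/
theorem exists_forall_codeWt_eq_succ
    {F : Type*} [Field F] [Fintype F] {n s : ℕ} (hs : 1 ≤ s) (C : Submodule F (Fin n → F)) (c : ℕ)
    (h : ∀ D ≤ C, Module.finrank F D = s → codeWt D = c) :
    ∃ c', ∀ E ≤ C, Module.finrank F E = s + 1 → codeWt E = c' := by
  have hq : 1 < Fintype.card F := Fintype.one_lt_card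
  set q := Fintype.card F with hqdef
  refine ⟨c * (q ^ (s + 1) - 1) / (q ^ (s + 1) - q), fun E hE hEs => ?_⟩
  obtain ⟨a, ha⟩ := exists_forall_codeWt_eq_of_hyperplanes E hEs c
    fun D hD => h D (hD.trans hE)
  obtain ⟨D, hDE, hDs⟩ := exists_submodule_le_finrank_eq E (s := s) (by omega)
  have hD := ha D hDE
  have hE' := ha E le_rfl
  rw [h D (hDE.trans hE) hDs, hDs, Nat.add_sub_cancel_left, pow_one, ← hqdef] at hD
  rw [hEs, Nat.sub_self, pow_zero, ← hqdef] at hE'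
  have hpos : 0 < q ^ (s + 1) - q :=
    Nat.sub_pos_of_lt (lt_self_pow₀ hq (by omega))
  refine (Nat.div_eq_of_eq_mul_left hpos ?_).symm
  refine Nat.eq_of_mul_eq_mul_left (Nat.sub_pos_of_lt hq) ?_
  calc (q - 1) * (c * (q ^ (s + 1) - 1))
      = ((q - 1) * c) * (q ^ (s + 1) - 1) := by ring
    _ = (a * (q ^ (s + 1) - 1)) * (q ^ (s + 1) - q) := by rw [hD]; ring
    _ = (q - 1) * (codeWt E * (q ^ (s + 1) - q)) := by rw [← hE']; ring

/-- If all `s`-dimensional subcodes of a code have the same weight, with `s` positive and smaller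
than the dimension, then the weight of a subcode is proportional to the number of functionals that
do not vanish on it. -/
theorem exists_forall_codeWt_eq_of_lt_finrank
    {F : Type*} [Field F] [Fintype F] {n : ℕ} (C : Submodule F (Fin n → F)) (j : ℕ) :
    ∀ (s c : ℕ), 1 ≤ s → Module.finrank F C = s + j + 1 →
      (∀ D ≤ C, Module.finrank F D = s → codeWt D = c) →
      ∃ a : ℕ, ∀ D ≤ C, (Fintype.card F - 1) * codeWt D =
        a * (Fintype.card F ^ Module.finrank F C -
          Fintype.card F ^ (Module.finrank F C - Module.finrank F D)) := by
  induction j with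
  | zero =>
    intro s c _ hC h
    rw [hC]
    exact exists_forall_codeWt_eq_of_hyperplanes C hC c h
  | succ j ih =>
    intro s c hs hC h
    obtain ⟨c', hc'⟩ := exists_forall_codeWt_eq_succ hs C c h
    exact ih (s + 1) c' (by omega) (by omega) hc'

/-- If all `s`-dimensional subcodes of a `k`-dimensional code `C` have the same weight `dₛ`
(for some `1 ≤ s ≤ k - 1`), then for every `0 ≤ t ≤ k`, every `t`-dimensional subcode `D`
satisfies `(q^k - q^(k-s)) * w(D) = dₛ * (q^k - q^(k-t))`. -/
theorem constant_weight_in_dim_s_determines_all_weights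
    {F : Type*} [Field F] [Fintype F] {n k q s : ℕ} (hq : Fintype.card F = q)
    (C : Submodule F (Fin n → F)) (hk : Module.finrank F C = k)
    (hs1 : 1 ≤ s) (hsk : s ≤ k - 1) (ds : ℕ)
    (hconst : ∀ D : Submodule F (Fin n → F), D ≤ C → Module.finrank F D = s →
      codeWt D = ds) :
    ∀ t ≤ k, ∀ D : Submodule F (Fin n → F), D ≤ C → Module.finrank F D = t →
      (q ^ k - q ^ (k - s)) * codeWt D = ds * (q ^ k - q ^ (k - t)) := by
  intro t _ D hD hDt
  subst hq hk hDt
  obtain ⟨a, ha⟩ := exists_forall_codeWt_eq_of_lt_finrank C (Module.finrank F C - s - 1) s ds hs1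
    (by omega) hconst
  obtain ⟨S, hS, hSs⟩ := exists_submodule_le_finrank_eq C (s := s) (by omega)
  have hds := ha S hS
  rw [hconst S hS hSs, hSs] at hds
  refine Nat.eq_of_mul_eq_mul_left (Nat.sub_pos_of_lt (Fintype.one_lt_card (α := F))) ?_
  rw [mul_left_comm, ha D hD, ← mul_assoc _ ds, hds]
  ring
end

section
/- Let C be a constant weight [n,k]_q code, let C' be a subcode of C, and let c be a codeword of C. Then c ∈ C' if and only if Supp(c) ⊆ Supp(C'). -/
/-- If at every coordinate `c` agrees with some element of `D`, then translating by `c` does not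
change the total weight of `D`. -/
theorem sum_hammingNorm_add_eq {F : Type*} [Field F] [DecidableEq F] {n : ℕ}
    (D : Submodule F (Fin n → F)) [Fintype D] (c : Fin n → F) (h : ∀ x, ∃ w ∈ D, w x = c x) :
    ∑ v : D, hammingNorm ((v : Fin n → F) + c) = ∑ v : D, hammingNorm (v : Fin n → F) := by
  simp only [hammingNorm, Finset.card_filter]
  rw [Finset.sum_comm, Finset.sum_comm (s := (Finset.univ : Finset D))]
  refine Finset.sum_congr rfl fun x _ => ?_
  obtain ⟨w, hw, hwx⟩ := h x
  rw [← Equiv.sum_comp (Equiv.addRight (⟨w, hw⟩ : D)) fun v => if (v : Fin n → F) x ≠ 0 then 1 else 0]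
  simp [hwx]

/-- A vector whose support lies in the support of `D` agrees at every coordinate with some element
of `D`. -/
theorem exists_mem_apply_eq_of_supp_subset {F : Type*} [Field F] {n : ℕ}
    {D : Submodule F (Fin n → F)} {c : Fin n → F} (h : {x | c x ≠ 0} ⊆ codeSupp D) (x : Fin n) :
    ∃ w ∈ D, w x = c x := by
  by_cases hx : c x = 0
  · exact ⟨0, D.zero_mem, hx.symm⟩
  · obtain ⟨w, hw, hwx⟩ := h hx
    exact ⟨(c x / w x) • w, D.smul_mem _ hw, by simp [hwx]⟩

/-- For a constant weight code `C`, a subcode `C'` of `C` and a codeword `c ∈ C`, we have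
`c ∈ C'` if and only if `Supp(c) ⊆ Supp(C')`. -/
theorem mem_subcode_iff_supp_subset
    {F : Type*} [Field F] [Fintype F] {n k d : ℕ}
    (C : Submodule F (Fin n → F)) (hk : Module.finrank F C = k)
    (hconst : ∀ c ∈ C, c ≠ 0 → ({x | c x ≠ 0} : Set (Fin n)).ncard = d)
    (C' : Submodule F (Fin n → F)) (hC' : C' ≤ C)
    (c : Fin n → F) (hc : c ∈ C) :
    c ∈ C' ↔ {x | c x ≠ 0} ⊆ codeSupp C' := by
  classical
  refine ⟨fun h x hx => ⟨c, h, hx⟩, fun h => ?_⟩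
  by_contra hcC'
  have weight_eq : ∀ v ∈ C, v ≠ 0 → hammingNorm v = d := fun v hv hv0 => by
    rw [← hconst v hv hv0, Set.ncard_eq_toFinset_card', Set.toFinset_ofPred, hammingNorm]
  have hlt : ∑ v : C', hammingNorm (v : Fin n → F) <
      ∑ v : C', hammingNorm ((v : Fin n → F) + c) := by
    have hadd : ∀ v : C', hammingNorm ((v : Fin n → F) + c) = d := fun v =>
      weight_eq _ (C.add_mem (hC' v.2) hc) fun h0 =>
        hcC' (by simp [eq_neg_of_add_eq_zero_right h0])
    refine Finset.sum_lt_sum (fun v _ => ?_) ⟨0, Finset.mem_univ _, ?_⟩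
    · rw [hadd]
      by_cases hv : (v : Fin n → F) = 0
      · simp [hv]
      · exact (weight_eq v (hC' v.2) hv).le
    · have hc0 : c ≠ 0 := fun h0 => hcC' (h0 ▸ C'.zero_mem)
      simpa using hc0
  exact hlt.ne' (sum_hammingNorm_add_eq C' c (exists_mem_apply_eq_of_supp_subset h))
end

section
/- Let C be a constant weight [n,k]_q code and let 0 ≤ i ≤ k. Then N_i = {Supp(C') : C' is an i-dimensional subcode of C}; that is, a subset σ ⊆ {1,…,n} is minimal under inclusion with dim C(σ) = i if and only if σ is the support of some i-dimensional subcode of C. -/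
/-- `C(σ)`: the subcode of `C` consisting of codewords whose support lies in `σ`. Its
dimension equals the nullity `|σ| - rank(σ)` of `σ` in the matroid of a parity check
matrix of `C`. -/
def codeOn {F : Type*} [Field F] {n : ℕ} (C : Submodule F (Fin n → F)) (σ : Set (Fin n)) :
    Submodule F (Fin n → F) where
  carrier := {c | c ∈ C ∧ ∀ x ∉ σ, c x = 0}
  add_mem' := by
    rintro a b ⟨ha, ha'⟩ ⟨hb, hb'⟩
    exact ⟨C.add_mem ha hb, fun x hx => by simp [ha' x hx, hb' x hx]⟩
  zero_mem' := ⟨C.zero_mem, fun x _ => rfl⟩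
  smul_mem' := by
    rintro r a ⟨ha, ha'⟩
    exact ⟨C.smul_mem r ha, fun x hx => by simp [ha' x hx]⟩

theorem codeOn_le {F : Type*} [Field F] {n : ℕ} (C : Submodule F (Fin n → F))
    (σ : Set (Fin n)) : codeOn C σ ≤ C :=
  fun _ hc => hc.1

theorem codeOn_mono {F : Type*} [Field F] {n : ℕ} (C : Submodule F (Fin n → F))
    {σ τ : Set (Fin n)} (h : σ ⊆ τ) : codeOn C σ ≤ codeOn C τ :=
  fun _ hc => ⟨hc.1, fun x hx => hc.2 x fun hx' => hx (h hx')⟩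

theorem codeSupp_codeOn_subset {F : Type*} [Field F] {n : ℕ} (C : Submodule F (Fin n → F))
    (σ : Set (Fin n)) : codeSupp (codeOn C σ) ⊆ σ := by
  rintro x ⟨c, hc, hx⟩
  by_contra hxσ
  exact hx (hc.2 x hxσ)

theorem le_codeOn_codeSupp {F : Type*} [Field F] {n : ℕ} {C D : Submodule F (Fin n → F)}
    (h : D ≤ C) : D ≤ codeOn C (codeSupp D) := by
  refine fun c hc => ⟨h hc, fun x hx => ?_⟩
  by_contra hne
  exact hx ⟨c, hc, hne⟩

/-- Translating a code `D` by a word `c` supported in `Supp(D)` does not change the total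
weight: in each coordinate of the support, `c` agrees with some word of `D`. -/
theorem sum_weight_add_eq {F : Type*} [Field F] {n : ℕ} (D : Submodule F (Fin n → F))
    [Fintype D] (c : Fin n → F) (hc : ∀ x ∉ codeSupp D, c x = 0) :
    ∑ e : D, ({x | ((e : Fin n → F) + c) x ≠ 0} : Set (Fin n)).ncard =
      ∑ e : D, ({x | (e : Fin n → F) x ≠ 0} : Set (Fin n)).ncard := by
  classical
  have hcard : ∀ v : Fin n → F,
      ({x | v x ≠ 0} : Set (Fin n)).ncard = ∑ x, if v x ≠ 0 then 1 else 0 := by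
    intro v
    rw [Set.ncard_eq_toFinset_card', Set.toFinset_ofPred, Finset.card_filter]
  simp only [hcard]
  rw [Finset.sum_comm, Finset.sum_comm (s := (Finset.univ : Finset D))]
  refine Finset.sum_congr rfl fun x _ => ?_
  by_cases hx : x ∈ codeSupp D
  · obtain ⟨b, hb, hbx⟩ := hx
    let t : D := ⟨(c x / b x) • b, D.smul_mem _ hb⟩
    have ht : (t : Fin n → F) x = c x := by
      simp [t, div_mul_cancel₀ _ hbx]
    refine Fintype.sum_equiv (Equiv.addRight t) _ _ fun e => ?_
    simp [ht]
  · simp [hc x hx]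

/-- A subcode of a constant weight code is determined by its support. -/
theorem codeOn_codeSupp {F : Type*} [Field F] [Fintype F] {n d : ℕ}
    {C D : Submodule F (Fin n → F)}
    (hconst : ∀ c ∈ C, c ≠ 0 → ({x | c x ≠ 0} : Set (Fin n)).ncard = d) (h : D ≤ C) :
    codeOn C (codeSupp D) = D := by
  classical
  refine le_antisymm (fun c hc => ?_) (le_codeOn_codeSupp h)
  by_contra hcD
  have hc0 : c ≠ 0 := fun h0 => hcD (h0 ▸ D.zero_mem)
  have : Fintype D := Fintype.ofFinite D
  have hsum := sum_weight_add_eq D c hc.2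
  refine hsum.not_gt (Finset.sum_lt_sum (fun e _ => ?_) ⟨0, Finset.mem_univ _, ?_⟩)
  all_goals have hd := hconst c hc.1 hc0
  · have hne : (e : Fin n → F) + c ≠ 0 := fun h0 =>
      hcD (by rw [eq_neg_of_add_eq_zero_right h0]; exact D.neg_mem e.2)
    rw [hconst _ (C.add_mem (h e.2) hc.1) hne]
    by_cases he : (e : Fin n → F) = 0
    · simp [he]
    · exact (hconst _ (h e.2) he).le
  · obtain ⟨x, hx⟩ := Function.ne_iff.mp hc0
    have hpos : 0 < ({x | c x ≠ 0} : Set (Fin n)).ncard :=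
      (Set.ncard_pos (Set.toFinite _)).mpr ⟨x, hx⟩
    simpa using hpos

/-- For a constant weight code `C` and `0 ≤ i ≤ k`, `N_i` is exactly the set of supports
of `i`-dimensional subcodes of `C`: `σ` is minimal under inclusion with `dim C(σ) = i` if
and only if `σ = Supp(C')` for some `i`-dimensional subcode `C'` of `C`. -/
theorem Ni_eq_supports_of_subcodes
    {F : Type*} [Field F] [Fintype F] {n k i d : ℕ}
    (C : Submodule F (Fin n → F)) (hk : Module.finrank F C = k) (hik : i ≤ k)
    (hconst : ∀ c ∈ C, c ≠ 0 → ({x | c x ≠ 0} : Set (Fin n)).ncard = d)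
    (σ : Set (Fin n)) :
    Minimal (fun τ : Set (Fin n) => Module.finrank F (codeOn C τ) = i) σ ↔
      ∃ C' : Submodule F (Fin n → F), C' ≤ C ∧ Module.finrank F C' = i ∧
        codeSupp C' = σ := by
  constructor
  · intro hmin
    refine ⟨codeOn C σ, codeOn_le C σ, hmin.prop, ?_⟩
    have hsub := codeSupp_codeOn_subset C σ
    refine hsub.antisymm (hmin.le_of_le ?_ hsub)
    rw [codeOn_codeSupp hconst (codeOn_le C σ)]
    exact hmin.prop
  · rintro ⟨D, hDC, hDi, rfl⟩
    have hD := codeOn_codeSupp hconst hDC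
    refine ⟨by beta_reduce; rw [hD, hDi], fun τ hτ hle => ?_⟩
    have hτD : codeOn C τ = D := by
      refine Submodule.eq_of_le_of_finrank_eq ?_ (hτ.trans hDi.symm)
      exact (codeOn_mono C hle).trans hD.le
    calc codeSupp D = codeSupp (codeOn C τ) := by rw [hτD]
      _ ⊆ τ := codeSupp_codeOn_subset C τ
end
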